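/- For every k ≥ 2, every Kripke structure K, and every world u ∈ dom(K), there exists a Kripke structure K̂ of tree-width at most k−1 and a world û ∈ dom(K̂) such that K,u ⇄_k K̂,û (k-bisimilar). Moreover, if K is countable then K̂ admits a countable good tree decomposition of width at most k−1. -/

import Mathlib

namespace PaperCPDL

/-- Relational structures over a fixed countably infinite signature:
for every arity `n` there are countably many relation names, indexed by `ℕ`. -/
structure Struct : Type 1 where
  World : Type
  rel : (n : ℕ) → ℕ → (Fin n → World) → Prop

namespace Struct

variable (K : Struct)

/-- Atomic propositions are the unary relation names. -/
def prop (p : ℕ) (w : K.World) : Prop := K.rel 1 p fun _ => w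

/-- Atomic programs are the binary relation names. -/
def prog (a : ℕ) (u v : K.World) : Prop :=
  K.rel 2 a fun i => if (i : ℕ) = 0 then u else v

/-- A Kripke structure interprets every relation of arity `> 2` as the empty relation. -/
def IsKripke : Prop := ∀ n, 2 < n → ∀ r (t : Fin n → K.World), ¬ K.rel n r t

/-- Gaifman adjacency: `u` and `v` occur together in a tuple of some relation. -/
def gadj (u v : K.World) : Prop :=
  ∃ (n r : ℕ) (t : Fin n → K.World), K.rel n r t ∧ (∃ i, t i = u) ∧ ∃ j, t j = v

/-- distance at most 1 in the Gaifman graph. -/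
def near (u v : K.World) : Prop := u = v ∨ K.gadj u v

/-- same connected component of the Gaifman graph. -/
def sameComp (u v : K.World) : Prop := Relation.ReflTransGen K.gadj u v

/-- finite degree: every world has finitely many Gaifman-neighbours. -/
def FiniteDegree : Prop := ∀ u, {v | K.gadj u v}.Finite

end Struct

/-- r-atoms `R(x₁,…,xₙ)`: a relation name with its argument variables. -/
structure RAtom where
  name : ℕ
  args : List ℕ

mutual
  /-- Formulas of (U)CPDL⁺ (together with `loop` and program intersection,
  used to carve out the various fragments). -/
  inductive Fml : Type where
    | prop : ℕ → Fml
    | neg : Fml → Fml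
    | and : Fml → Fml → Fml
    | diam : Prog → Fml
    | loop : Prog → Fml
  /-- Programs. -/
  inductive Prog : Type where
    | eps : Prog
    | atom : ℕ → Prog
    | conv : ℕ → Prog
    | union : Prog → Prog → Prog
    | comp : Prog → Prog → Prog
    | star : Prog → Prog
    | test : Fml → Prog
    | inter : Prog → Prog → Prog
    | univ : Prog
    | cq : PList → List RAtom → ℕ → ℕ → Prog
  /-- Finite lists of p-atoms `π(x,y)`. -/
  inductive PList : Type where
    | nil : PList
    | cons : Prog → ℕ → ℕ → PList → PList
end

/-- satisfaction of an r-atom under an assignment. -/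
def Struct.ratomSat (K : Struct) (f : ℕ → K.World) (r : RAtom) : Prop :=
  K.rel r.args.length r.name fun i => f (r.args.get i)

mutual
  /-- semantics of formulas. -/
  def evalF (K : Struct) : Fml → K.World → Prop
    | .prop p, w => K.prop p w
    | .neg φ, w => ¬ evalF K φ w
    | .and φ ψ, w => evalF K φ w ∧ evalF K ψ w
    | .diam π, w => ∃ v, evalP K π w v
    | .loop π, w => evalP K π w w
  /-- semantics of programs. -/
  def evalP (K : Struct) : Prog → K.World → K.World → Prop
    | .eps, u, v => u = v
    | .atom a, u, v => K.prog a u v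
    | .conv a, u, v => K.prog a v u
    | .union π₁ π₂, u, v => evalP K π₁ u v ∨ evalP K π₂ u v
    | .comp π₁ π₂, u, v => ∃ w, evalP K π₁ u w ∧ evalP K π₂ w v
    | .star π, u, v => Relation.ReflTransGen (fun a b => evalP K π a b) u v
    | .test φ, u, v => u = v ∧ evalF K φ u
    | .inter π₁ π₂, u, v => evalP K π₁ u v ∧ evalP K π₂ u v
    | .univ, _, _ => True
    | .cq ps rs xs xt, u, v =>
        ∃ f : ℕ → K.World, f xs = u ∧ f xt = v ∧ evalPL K f ps ∧ ∀ r ∈ rs, K.ratomSat f r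
  /-- semantics of a list of p-atoms. -/
  def evalPL (K : Struct) (f : ℕ → K.World) : PList → Prop
    | .nil => True
    | .cons π x y ps => evalP K π (f x) (f y) ∧ evalPL K f ps
end

/-! ## Conjunctive programs: variables, underlying graph, well-formedness -/

/-- variables occurring in a list of p-atoms. -/
def PList.vars : PList → List ℕ
  | .nil => []
  | .cons _ x y ps => x :: y :: ps.vars

/-- variables of a conjunctive program given by p-atoms `ps` and r-atoms `rs`. -/
def cqVars (ps : PList) (rs : List RAtom) : List ℕ :=
  ps.vars ++ (rs.map RAtom.args).flatten

/-- co-occurrence of two variables in a p-atom of the list. -/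
def PList.coOcc (x y : ℕ) : PList → Prop
  | .nil => False
  | .cons _ a b ps => ((x = a ∨ x = b) ∧ (y = a ∨ y = b)) ∨ PList.coOcc x y ps

/-- adjacency in the graph `G_C`: co-occurrence of two variables in some atom. -/
def atomAdj (ps : PList) (rs : List RAtom) (x y : ℕ) : Prop :=
  ps.coOcc x y ∨ ∃ r ∈ rs, x ∈ r.args ∧ y ∈ r.args

/-- adjacency in the underlying graph of `C[x_s,x_t]`: `G_C` plus the edge `{x_s,x_t}`. -/
def ugAdj (ps : PList) (rs : List RAtom) (xs xt : ℕ) (x y : ℕ) : Prop :=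
  atomAdj ps rs x y ∨ (x = xs ∧ y = xt) ∨ (x = xt ∧ y = xs)

/-- base well-formedness of a conjunctive program `C[x_s,x_t]`:
`x_s,x_t ∈ Vars(C)`, every r-atom has arity `> 2`, and `G_C` is connected. -/
def cqWF (ps : PList) (rs : List RAtom) (xs xt : ℕ) : Prop :=
  xs ∈ cqVars ps rs ∧ xt ∈ cqVars ps rs ∧
  (∀ r ∈ rs, 2 < r.args.length) ∧
  ∀ x ∈ cqVars ps rs, ∀ y ∈ cqVars ps rs, Relation.ReflTransGen (atomAdj ps rs) x y

/-! ## Tree decompositions and tree-width -/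

/-- A tree decomposition of the graph with vertex set `V` and adjacency `adj`. -/
structure TreeDecomp {α : Type} (V : Set α) (adj : α → α → Prop) where
  /-- the nodes of the tree -/
  B : Type
  /-- the tree -/
  tree : SimpleGraph B
  isTree : tree.IsTree
  /-- the bags -/
  bag : B → Set α
  cover_vert : ∀ v ∈ V, ∃ b, v ∈ bag b
  cover_edge : ∀ u v, adj u v → ∃ b, u ∈ bag b ∧ v ∈ bag b
  bags_conn : ∀ (v : α) (b₁ b₂ : B), v ∈ bag b₁ → v ∈ bag b₂ →
      ∃ p : tree.Walk b₁ b₂, ∀ x ∈ p.support, v ∈ bag x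

/-- the width of a tree decomposition is at most `k`. -/
def TreeDecomp.WidthLE {α : Type} {V : Set α} {adj : α → α → Prop}
    (td : TreeDecomp V adj) (k : ℕ) : Prop :=
  ∀ b, (td.bag b).Finite ∧ (td.bag b).ncard ≤ k + 1

/-- the graph `(V, adj)` has tree-width at most `k`. -/
def TreewidthLE {α : Type} (V : Set α) (adj : α → α → Prop) (k : ℕ) : Prop :=
  ∃ td : TreeDecomp V adj, td.WidthLE k

/-- the Gaifman graph of the structure `K` has tree-width at most `k`. -/
def Struct.twLE (K : Struct) (k : ℕ) : Prop :=
  TreewidthLE (Set.univ : Set K.World) K.gadj k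

/-- A good tree decomposition: along every tree edge one bag contains the other,
and the tree is binary (it has a root of degree `≤ 2`, all other nodes have degree `≤ 3`). -/
def TreeDecomp.Good {α : Type} {V : Set α} {adj : α → α → Prop} (td : TreeDecomp V adj) : Prop :=
  (∀ b b', td.tree.Adj b b' → td.bag b ⊆ td.bag b' ∨ td.bag b' ⊆ td.bag b) ∧
  ∃ r : td.B, ∀ b, {b' | td.tree.Adj b b'}.Finite ∧
    ((b = r → {b' | td.tree.Adj b b'}.ncard ≤ 2) ∧ (b ≠ r → {b' | td.tree.Adj b b'}.ncard ≤ 3))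

/-! ## Fragments -/

/-- all p-atoms of the list are of the form `π(x,x)` for the fixed variable `x`. -/
def PList.allOn (x : ℕ) : PList → Prop
  | .nil => True
  | .cons _ a b ps => a = x ∧ b = x ∧ PList.allOn x ps

/-- A fragment specification: which of `loop`, `∩`, `U` are allowed, and which
shapes of conjunctive programs are allowed. -/
structure Frag where
  loopOK : Prop
  interOK : Prop
  univOK : Prop
  cqOK : PList → List RAtom → ℕ → ℕ → Prop

mutual
  /-- the formula belongs to the fragment `F`. -/
  def Fml.In : Frag → Fml → Prop
    | _, .prop _ => True
    | F, .neg φ => Fml.In F φ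
    | F, .and φ ψ => Fml.In F φ ∧ Fml.In F ψ
    | F, .diam π => Prog.In F π
    | F, .loop π => F.loopOK ∧ Prog.In F π
  /-- the program belongs to the fragment `F`. -/
  def Prog.In : Frag → Prog → Prop
    | _, .eps => True
    | _, .atom _ => True
    | _, .conv _ => True
    | F, .union π₁ π₂ => Prog.In F π₁ ∧ Prog.In F π₂
    | F, .comp π₁ π₂ => Prog.In F π₁ ∧ Prog.In F π₂
    | F, .star π => Prog.In F π
    | F, .test φ => Fml.In F φ
    | F, .inter π₁ π₂ => F.interOK ∧ Prog.In F π₁ ∧ Prog.In F π₂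
    | F, .univ => F.univOK
    | F, .cq ps rs xs xt => F.cqOK ps rs xs xt ∧ cqWF ps rs xs xt ∧ PList.In F ps
  /-- all programs of the list belong to the fragment `F`. -/
  def PList.In : Frag → PList → Prop
    | _, .nil => True
    | F, .cons π _ _ ps => Prog.In F π ∧ PList.In F ps
end

/-- CPDL: PDL with converse. -/
def Frag.cpdl : Frag := ⟨False, False, False, fun _ _ _ _ => False⟩
/-- ICPDL: CPDL with program intersection. -/
def Frag.icpdl : Frag := ⟨False, True, False, fun _ _ _ _ => False⟩
/-- loop-CPDL: CPDL with `loop(π)` formulas. -/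
def Frag.loopCpdl : Frag := ⟨True, False, False, fun _ _ _ _ => False⟩
/-- CPDL⁺: CPDL with conjunctive programs. -/
def Frag.cpdlPlus : Frag := ⟨False, False, False, fun _ _ _ _ => True⟩
/-- UCPDL⁺: CPDL⁺ with the universal program. -/
def Frag.ucpdlPlus : Frag := ⟨False, False, True, fun _ _ _ _ => True⟩
/-- CPDL⁺(TW_k): conjunctive programs with underlying graph of tree-width `≤ k`. -/
def Frag.tw (k : ℕ) : Frag :=
  ⟨False, False, False, fun ps rs xs xt =>
    TreewidthLE {x | x ∈ cqVars ps rs} (ugAdj ps rs xs xt) k⟩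
/-- UCPDL⁺(TW_k). -/
def Frag.utw (k : ℕ) : Frag :=
  ⟨False, False, True, fun ps rs xs xt =>
    TreewidthLE {x | x ∈ cqVars ps rs} (ugAdj ps rs xs xt) k⟩
/-- CPDL⁺(𝒢↺): the only conjunctive programs are `C[x,x]` where all atoms
are p-atoms of the form `π(x,x)`. -/
def Frag.gloop : Frag :=
  ⟨False, False, False, fun ps rs xs xt => xt = xs ∧ rs = [] ∧ PList.allOn xs ps⟩
/-- ICPDL⁺(TW₂): CPDL⁺(TW₂) together with program intersection. -/
def Frag.icpdlPlusTw2 : Frag :=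
  ⟨False, True, False, fun ps rs xs xt =>
    TreewidthLE {x | x ∈ cqVars ps rs} (ugAdj ps rs xs xt) 2⟩

mutual
  /-- positive formulas: no occurrence of negation. -/
  def Fml.Positive : Fml → Prop
    | .prop _ => True
    | .neg _ => False
    | .and φ ψ => Fml.Positive φ ∧ Fml.Positive ψ
    | .diam π => Prog.Positive π
    | .loop π => Prog.Positive π
  /-- positive programs. -/
  def Prog.Positive : Prog → Prop
    | .eps => True
    | .atom _ => True
    | .conv _ => True
    | .union π₁ π₂ => Prog.Positive π₁ ∧ Prog.Positive π₂
    | .comp π₁ π₂ => Prog.Positive π₁ ∧ Prog.Positive π₂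
    | .star π => Prog.Positive π
    | .test φ => Fml.Positive φ
    | .inter π₁ π₂ => Prog.Positive π₁ ∧ Prog.Positive π₂
    | .univ => True
    | .cq ps _ _ _ => PList.Positive ps
  /-- positive p-atom lists. -/
  def PList.Positive : PList → Prop
    | .nil => True
    | .cons π _ _ ps => Prog.Positive π ∧ PList.Positive ps
end

/-! ## Pebble games -/

/-- A two-player arena; the winning condition for Duplicator is "any infinite play"
(the stuck player loses). -/
structure GameArena (Pos : Type) where
  /-- positions owned by Spoiler -/
  spoiler : Pos → Prop
  /-- the moves -/
  move : Pos → Pos → Prop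

/-- `W` is a set of positions from which Duplicator survives forever: it is closed
under all Spoiler moves and from each Duplicator position of `W` some move stays in `W`. -/
def GameArena.Invariant {Pos : Type} (G : GameArena Pos) (W : Set Pos) : Prop :=
  ∀ q ∈ W, (G.spoiler q → ∀ q', G.move q q' → q' ∈ W) ∧
    (¬ G.spoiler q → ∃ q', G.move q q' ∧ q' ∈ W)

/-- Duplicator has a winning strategy from `q` (coinductive characterization of
winning regions of safety games). -/
def GameArena.DupWins {Pos : Type} (G : GameArena Pos) (q : Pos) : Prop :=
  ∃ W : Set Pos, G.Invariant W ∧ q ∈ W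

/-- `(u,v) ∈ Homs_m(K,K')`: the assignment `u i ↦ v i` is a well-defined partial
homomorphism from `K` to `K'`. -/
def tupHom (K K' : Struct) {m : ℕ} (u : Fin m → K.World) (v : Fin m → K'.World) : Prop :=
  (∀ i j, u i = u j → v i = v j) ∧
  ∀ (n r : ℕ) (t : Fin n → Fin m),
    K.rel n r (fun i => u (t i)) → K'.rel n r fun i => v (t i)

/-- Game positions: Spoiler positions `S ū v̄` and Duplicator positions `D i ū v̄`
(`i = none` is the position `d₀` of the U-games). -/
inductive GPos (A B : Type) (m : ℕ) : Type where
  | S : (Fin m → A) → (Fin m → B) → GPos A B m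
  | D : Option (Fin m) → (Fin m → A) → (Fin m → B) → GPos A B m

/-- Spoiler's positions. -/
def GPos.isS {A B : Type} {m : ℕ} : GPos A B m → Prop
  | .S _ _ => True
  | .D _ _ _ => False

/-- moves of the `m`-pebble simulation game on `(K,K')`; `withU` enables the
additional `d₀` moves of the U-simulation game. -/
def simMove (K K' : Struct) (m : ℕ) (withU : Bool) :
    GPos K.World K'.World m → GPos K.World K'.World m → Prop
  | .S u v, .D (some i) u' v' =>
      v' = v ∧ ∃ w, u' = Function.update u i w ∧ ∃ j, j ≠ i ∧ K.near (u j) w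
  | .S _ v, .D none u' v' =>
      withU = true ∧ v' = v ∧ ∀ i j, u' i = u' j
  | .D (some i) u v, .S u' v' =>
      u' = u ∧ (∃ w, v' = Function.update v i w ∧ ∃ j, j ≠ i ∧ K'.near (v j) w) ∧
      tupHom K K' u' v'
  | .D none u v, .S u' v' =>
      u' = u ∧ (∀ i j, v' i = v' j) ∧ tupHom K K' u' v'
  | _, _ => False

/-- the `m`-pebble (U-)simulation game. -/
def simGame (K K' : Struct) (m : ℕ) (withU : Bool) : GameArena (GPos K.World K'.World m) :=
  ⟨GPos.isS, simMove K K' m withU⟩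

/-- `K,ū ⪯_m K',v̄`: `m`-pebble simulation. -/
def PebbleSim (K K' : Struct) (m : ℕ) (u : Fin m → K.World) (v : Fin m → K'.World) : Prop :=
  (∀ i j, K.sameComp (u i) (u j)) →
    tupHom K K' u v ∧ (simGame K K' m false).DupWins (.S u v)

/-- `K,ū ⪯ᵁ_m K',v̄`: `m`-pebble U-simulation. -/
def PebbleSimU (K K' : Struct) (m : ℕ) (u : Fin m → K.World) (v : Fin m → K'.World) : Prop :=
  tupHom K K' u v ∧ (simGame K K' m true).DupWins (.S u v)

/-- the disjoint union of two structures. -/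
def Struct.sum (K K' : Struct) : Struct where
  World := K.World ⊕ K'.World
  rel n r t :=
    (∃ t₀ : Fin n → K.World, t = (fun i => Sum.inl (t₀ i)) ∧ K.rel n r t₀) ∨
    ∃ t₁ : Fin n → K'.World, t = (fun i => Sum.inr (t₁ i)) ∧ K'.rel n r t₁

/-- moves of the `m`-pebble bisimulation game, played on the disjoint union `U`;
`side` tells which of the two structures hosts a world.  Besides the simulation
moves, Spoiler may swap the two tuples whenever all his pebbles are stacked,
and (`withU`) may stack all his pebbles anywhere in his current structure. -/
def bisimMove (U : Struct) (m : ℕ) (withU : Bool) (side : U.World → Bool) :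
    GPos U.World U.World m → GPos U.World U.World m → Prop
  | .S u v, .D (some i) u' v' =>
      v' = v ∧ ∃ w, u' = Function.update u i w ∧ ∃ j, j ≠ i ∧ U.near (u j) w
  | .S u v, .S u' v' =>
      u' = v ∧ v' = u ∧ ∀ i j, u i = u j
  | .S u v, .D none u' v' =>
      withU = true ∧ v' = v ∧ (∀ i j, u' i = u' j) ∧ ∀ i j, side (u' i) = side (u j)
  | .D (some i) u v, .S u' v' =>
      u' = u ∧ (∃ w, v' = Function.update v i w ∧ ∃ j, j ≠ i ∧ U.near (v j) w) ∧
      tupHom U U u' v' ∧ ∀ i j, side (u' i) ≠ side (v' j)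
  | .D none u v, .S u' v' =>
      u' = u ∧ (∀ i j, v' i = v' j) ∧ tupHom U U u' v' ∧ ∀ i j, side (u' i) ≠ side (v' j)
  | _, _ => False

/-- the `m`-pebble (U-)bisimulation game on `(K,K')`. -/
def bisimGame (K K' : Struct) (m : ℕ) (withU : Bool) :
    GameArena (GPos (K.sum K').World (K.sum K').World m) :=
  ⟨GPos.isS, bisimMove (K.sum K') m withU (fun w => Sum.isLeft w)⟩

/-- `K,ū ⪯ʰ_m K',v̄`: `m`-half-bisimulation. -/
def HalfBisim (K K' : Struct) (m : ℕ) (u : Fin m → K.World) (v : Fin m → K'.World) : Prop :=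
  (∀ i j, K.sameComp (u i) (u j)) →
    tupHom K K' u v ∧
    (bisimGame K K' m false).DupWins (.S (fun i => Sum.inl (u i)) (fun i => Sum.inr (v i)))

/-- `K,ū ⪯ʰᵁ_m K',v̄`: `m`-half-U-bisimulation. -/
def HalfBisimU (K K' : Struct) (m : ℕ) (u : Fin m → K.World) (v : Fin m → K'.World) : Prop :=
  tupHom K K' u v ∧
  (bisimGame K K' m true).DupWins (.S (fun i => Sum.inl (u i)) (fun i => Sum.inr (v i)))

/-- `K,ū ⇄_m K',v̄`: `m`-bisimulation. -/
def Bisim (K K' : Struct) (m : ℕ) (u : Fin m → K.World) (v : Fin m → K'.World) : Prop :=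
  HalfBisim K K' m u v ∧ HalfBisim K' K m v u

/-- `K,ū ⇄ᵁ_m K',v̄`: `m`-U-bisimulation. -/
def BisimU (K K' : Struct) (m : ℕ) (u : Fin m → K.World) (v : Fin m → K'.World) : Prop :=
  HalfBisimU K K' m u v ∧ HalfBisimU K' K m v u

/-- padding of a single world to an `m`-tuple. -/
def pad1 {W : Type} (m : ℕ) (v : W) : Fin m → W := fun _ => v

/-- padding of a pair of worlds to an `m`-tuple `(u,v,v,…,v)`. -/
def pad2 {W : Type} (m : ℕ) (u v : W) : Fin m → W := fun i => if (i : ℕ) = 0 then u else v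

namespace Struct

variable {K K' : Struct}

/-- The left injection into the disjoint union. -/
def sumInl (K' : Struct) {K : Struct} (x : K.World) : (K.sum K').World := Sum.inl x

/-- The right injection into the disjoint union. -/
def sumInr (K : Struct) {K' : Struct} (x : K'.World) : (K.sum K').World := Sum.inr x

theorem near_sum_inl {x : K.World} {y : (K.sum K').World} :
    (K.sum K').near (sumInl K' x) y ↔ ∃ y', y = sumInl K' y' ∧ K.near x y' := by
  constructor
  · rintro (rfl | ⟨n, r, t, h, ⟨i, hi⟩, j, hj⟩)
    · exact ⟨x, rfl, Or.inl rfl⟩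
    · rcases h with ⟨t₀, rfl, h⟩ | ⟨t₁, rfl, h⟩
      · exact ⟨t₀ j, hj.symm, Or.inr ⟨n, r, t₀, h, ⟨i, Sum.inl_injective hi⟩, j, rfl⟩⟩
      · cases hi
  · rintro ⟨y', rfl, rfl | ⟨n, r, t, h, ⟨i, hi⟩, j, hj⟩⟩
    · exact Or.inl rfl
    · exact Or.inr ⟨n, r, fun a => Sum.inl (t a), Or.inl ⟨t, rfl, h⟩,
        ⟨i, congrArg Sum.inl hi⟩, j, congrArg Sum.inl hj⟩

theorem near_sum_inr {x : K'.World} {y : (K.sum K').World} :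
    (K.sum K').near (sumInr K x) y ↔ ∃ y', y = sumInr K y' ∧ K'.near x y' := by
  constructor
  · rintro (rfl | ⟨n, r, t, h, ⟨i, hi⟩, j, hj⟩)
    · exact ⟨x, rfl, Or.inl rfl⟩
    · rcases h with ⟨t₀, rfl, h⟩ | ⟨t₁, rfl, h⟩
      · cases hi
      · exact ⟨t₁ j, hj.symm, Or.inr ⟨n, r, t₁, h, ⟨i, Sum.inr_injective hi⟩, j, rfl⟩⟩
  · rintro ⟨y', rfl, rfl | ⟨n, r, t, h, ⟨i, hi⟩, j, hj⟩⟩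
    · exact Or.inl rfl
    · exact Or.inr ⟨n, r, fun a => Sum.inr (t a), Or.inr ⟨t, rfl, h⟩,
        ⟨i, congrArg Sum.inr hi⟩, j, congrArg Sum.inr hj⟩

end Struct

theorem tupHom.sum_inl_inr {K K' : Struct} {m : ℕ} {u : Fin m → K.World} {v : Fin m → K'.World}
    (h : tupHom K K' u v) :
    tupHom (K.sum K') (K.sum K') (fun i => Struct.sumInl K' (u i))
      (fun i => Struct.sumInr K (v i)) := by
  refine ⟨fun i j hij => congrArg Sum.inr (h.1 i j (Sum.inl_injective hij)), fun n r t ht => ?_⟩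
  refine Or.inr ⟨fun i => v (t i), rfl, ?_⟩
  rcases ht with ⟨t₀, h₀, ht⟩ | ⟨t₁, h₁, ht⟩
  · obtain rfl : (fun i => u (t i)) = t₀ := funext fun i => Sum.inl_injective (congrFun h₀ i)
    exact h.2 n r t ht
  · obtain rfl : (fun i => v (t i)) = t₁ := funext fun i => nomatch congrFun h₁ i
    exact ht

theorem tupHom.sum_inr_inl {K K' : Struct} {m : ℕ} {u : Fin m → K'.World} {v : Fin m → K.World}
    (h : tupHom K' K u v) :
    tupHom (K.sum K') (K.sum K') (fun i => Struct.sumInr K (u i))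
      (fun i => Struct.sumInl K' (v i)) := by
  refine ⟨fun i j hij => congrArg Sum.inl (h.1 i j (Sum.inr_injective hij)), fun n r t ht => ?_⟩
  refine Or.inl ⟨fun i => v (t i), rfl, ?_⟩
  rcases ht with ⟨t₀, h₀, ht⟩ | ⟨t₁, h₁, ht⟩
  · obtain rfl : (fun i => v (t i)) = t₀ := funext fun i => nomatch congrFun h₀ i
    exact ht
  · obtain rfl : (fun i => u (t i)) = t₁ := funext fun i => Sum.inr_injective (congrFun h₁ i)
    exact h.2 n r t ht

theorem comp_update {α β : Type} {m : ℕ} (f : α → β) (u : Fin m → α) (i : Fin m) (w : α) :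
    (fun j => f (Function.update u i w j)) = Function.update (fun j => f (u j)) i (f w) :=
  Function.comp_update f u i w

/-- A winning region for Duplicator: `Z` describes the Spoiler positions with Spoiler playing
in `K`, and `Z'` those with Spoiler playing in `K'`. -/
structure BisimStep (K K' : Struct) (m : ℕ)
    (Z : (Fin m → K.World) → (Fin m → K'.World) → Prop)
    (Z' : (Fin m → K'.World) → (Fin m → K.World) → Prop) : Prop where
  hom : ∀ {u v}, Z u v → tupHom K K' u v
  step : ∀ {u v}, Z u v → ∀ {i j w}, j ≠ i → K.near (u j) w →
    ∃ w', K'.near (v j) w' ∧ Z (Function.update u i w) (Function.update v i w')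
  swap : ∀ {u v}, Z u v → (∀ i j, u i = u j) → Z' v u

theorem BisimStep.halfBisim {K K' : Struct} {m : ℕ}
    {Z : (Fin m → K.World) → (Fin m → K'.World) → Prop}
    {Z' : (Fin m → K'.World) → (Fin m → K.World) → Prop}
    (hZ : BisimStep K K' m Z Z') (hZ' : BisimStep K' K m Z' Z)
    {u : Fin m → K.World} {v : Fin m → K'.World} (huv : Z u v) : HalfBisim K K' m u v := by
  intro _
  refine ⟨hZ.hom huv, ?_⟩
  let P : (Fin m → (K.sum K').World) → (Fin m → (K.sum K').World) → Prop := fun a b =>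
    (∃ u v, a = (fun i => Struct.sumInl K' (u i)) ∧ b = (fun i => Struct.sumInr K (v i)) ∧ Z u v) ∨
    (∃ u v, a = (fun i => Struct.sumInr K (u i)) ∧ b = (fun i => Struct.sumInl K' (v i)) ∧ Z' u v)
  let W : Set (GPos (K.sum K').World (K.sum K').World m) := {q | match q with
    | .S a b => P a b
    | .D d a b => ∃ b', (bisimGame K K' m false).move (.D d a b) (.S a b') ∧ P a b'}
  refine ⟨W, ?_, Or.inl ⟨u, v, rfl, rfl, huv⟩⟩
  rintro (⟨a, b⟩ | ⟨d, a, b⟩) hq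
  · refine ⟨fun _ q' hmove => ?_, fun h => absurd trivial h⟩
    rcases q' with ⟨a', b'⟩ | ⟨_ | i, a', b'⟩
    · obtain ⟨rfl, rfl, hc⟩ := hmove
      rcases hq with ⟨u, v, rfl, rfl, h⟩ | ⟨u, v, rfl, rfl, h⟩
      · exact Or.inr ⟨v, u, rfl, rfl, hZ.swap h fun i j => Sum.inl_injective (hc i j)⟩
      · exact Or.inl ⟨v, u, rfl, rfl, hZ'.swap h fun i j => Sum.inr_injective (hc i j)⟩
    · exact absurd hmove.1 (by simp)
    · obtain ⟨rfl, w, rfl, j, hj, hw⟩ := hmove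
      rcases hq with ⟨u, v, rfl, rfl, h⟩ | ⟨u, v, rfl, rfl, h⟩
      · obtain ⟨w, rfl, hw₀⟩ := Struct.near_sum_inl.1 hw
        obtain ⟨w', hw', h'⟩ := hZ.step h hj hw₀
        refine ⟨fun j => Struct.sumInr K (Function.update v i w' j),
          ⟨rfl, ⟨Struct.sumInr K w', comp_update _ _ _ _, j, hj,
            Struct.near_sum_inr.2 ⟨w', rfl, hw'⟩⟩, ?_, ?_⟩,
          Or.inl ⟨_, _, (comp_update _ _ _ _).symm, rfl, h'⟩⟩
        · rw [← comp_update]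
          exact (hZ.hom h').sum_inl_inr
        · rw [← comp_update]
          exact fun _ _ h => Bool.noConfusion h
      · obtain ⟨w, rfl, hw₀⟩ := Struct.near_sum_inr.1 hw
        obtain ⟨w', hw', h'⟩ := hZ'.step h hj hw₀
        refine ⟨fun j => Struct.sumInl K' (Function.update v i w' j),
          ⟨rfl, ⟨Struct.sumInl K' w', comp_update _ _ _ _, j, hj,
            Struct.near_sum_inl.2 ⟨w', rfl, hw'⟩⟩, ?_, ?_⟩,
          Or.inr ⟨_, _, (comp_update _ _ _ _).symm, rfl, h'⟩⟩
        · rw [← comp_update]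
          exact (hZ'.hom h').sum_inr_inl
        · rw [← comp_update]
          exact fun _ _ h => Bool.noConfusion h
  · refine ⟨fun h => h.elim, fun _ => ?_⟩
    obtain ⟨b', hmove, hb'⟩ := hq
    exact ⟨.S a b', hmove, hb'⟩

/-! ## Trees of lists -/

/-- The rooted tree of all lists over `A`, where the parent of `a :: l` is `l`. -/
def listTree (A : Type) : SimpleGraph (List A) where
  Adj l l' := (∃ a, l' = a :: l) ∨ ∃ a, l = a :: l'
  symm := ⟨fun _ _ h => h.symm⟩
  loopless := ⟨fun l h => by
    rcases h with ⟨a, h⟩ | ⟨a, h⟩ <;> exact absurd (congrArg List.length h) (by simp)⟩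

theorem listTree_adj_cons {A : Type} (a : A) (l : List A) : (listTree A).Adj (a :: l) l :=
  Or.inr ⟨a, rfl⟩

theorem listTree_isTree (A : Type) : (listTree A).IsTree := by
  have hreach : ∀ l : List A, (listTree A).Reachable l [] := by
    intro l
    induction l with
    | nil => exact .rfl
    | cons a l ih => exact (listTree_adj_cons a l).reachable.trans ih
  have hbridge : ∀ (a : A) (l : List A), (listTree A).IsBridge s(a :: l, l) := by
    intro a l h
    have key : ∀ x, Relation.ReflTransGen ((listTree A).deleteEdges {s(a :: l, l)}).Adj (a :: l) x →
        (a :: l) <:+ x := by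
      intro x hx
      induction hx with
      | refl => exact List.suffix_rfl
      | tail _ hxy ih =>
        obtain ⟨hadj, hne⟩ := SimpleGraph.deleteEdges_adj.1 hxy
        rcases hadj with ⟨b, rfl⟩ | ⟨b, rfl⟩
        · exact ih.trans (List.suffix_cons b _)
        · refine (List.suffix_cons_iff.1 ih).resolve_left fun e => hne ?_
          obtain ⟨rfl, rfl⟩ := List.cons.inj e
          rfl
    have hle := (key l ((SimpleGraph.reachable_iff_reflTransGen _ _).1 h)).length_le
    simp at hle
  refine ⟨⟨fun l l' => (hreach l).trans (hreach l').symm⟩,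
    SimpleGraph.isAcyclic_iff_forall_adj_isBridge.2 ?_⟩
  rintro _ _ (⟨a, rfl⟩ | ⟨a, rfl⟩)
  · rw [Sym2.eq_swap]
    exact hbridge a _
  · exact hbridge a _

theorem listTree_neighbors_bool (l : List Bool) :
    {l' | (listTree Bool).Adj l l'} ⊆ {true :: l, false :: l, l.tail} := by
  rintro l' (⟨_ | _, rfl⟩ | ⟨a, rfl⟩) <;> simp

theorem listTree_neighbors_bool_nil :
    {l' | (listTree Bool).Adj [] l'} ⊆ {[true], [false]} := by
  rintro l' (⟨_ | _, rfl⟩ | ⟨a, h⟩)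
  · simp
  · simp
  · cases h

/-! ## Unravelling -/

section Unravelling

variable {A W : Type}

/-- The effect of a move at a new node `b` on a bag: `inl S` keeps only the copies of the members
of `S`, and `inr w` adds a copy of `w` born at `b`, if there is room for it and no copy yet. -/
noncomputable def nextBag (k : ℕ) (b : List A) (B : Set (List A × W)) :
    Finset W ⊕ W → Set (List A × W)
  | .inl S => {x ∈ B | x.2 ∈ S}
  | .inr w =>
    open Classical in if B.ncard < k ∧ ∀ x ∈ B, x.2 ≠ w then insert (b, w) B else B

/-- The bag at each node of `listTree A`, where the move `mv b` (if any) is applied on entering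
the node `b`. An element `(b, w)` is a copy of `w` born at the node `b`. -/
noncomputable def unravelBag (k : ℕ) (u : W) (mv : List A → Option (Finset W ⊕ W)) :
    List A → Set (List A × W)
  | [] => {([], u)}
  | a :: l => (mv (a :: l)).elim (unravelBag k u mv l) (nextBag k (a :: l) (unravelBag k u mv l))

theorem nextBag_mono_or_anti (k : ℕ) (b : List A) (B : Set (List A × W)) (m : Finset W ⊕ W) :
    nextBag k b B m ⊆ B ∨ B ⊆ nextBag k b B m := by
  rcases m with S | w
  · exact Or.inl fun x hx => hx.1
  · refine Or.inr ?_
    dsimp only [nextBag]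
    split_ifs
    · exact Set.subset_insert _ _
    · exact subset_rfl

theorem mem_nextBag {k : ℕ} {b : List A} {B : Set (List A × W)} {m : Finset W ⊕ W}
    {x : List A × W} (h : x ∈ nextBag k b B m) : x ∈ B ∨ x.1 = b := by
  rcases m with S | w
  · exact Or.inl h.1
  · dsimp only [nextBag] at h
    split_ifs at h
    · rcases h with rfl | h
      · exact Or.inr rfl
      · exact Or.inl h
    · exact Or.inl h

theorem finite_ncard_nextBag {k : ℕ} {b : List A} {B : Set (List A × W)} {m : Finset W ⊕ W}
    (h : B.Finite ∧ B.ncard ≤ k) :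
    (nextBag k b B m).Finite ∧ (nextBag k b B m).ncard ≤ k := by
  rcases m with S | w
  · exact ⟨h.1.subset fun x hx => hx.1,
      (Set.ncard_le_ncard (fun x hx => hx.1) h.1).trans h.2⟩
  · dsimp only [nextBag]
    split_ifs with hc
    · exact ⟨h.1.insert _, (Set.ncard_insert_le _ _).trans hc.1⟩
    · exact h

theorem injOn_nextBag {k : ℕ} {b : List A} {B : Set (List A × W)} {m : Finset W ⊕ W}
    (h : Set.InjOn Prod.snd B) : Set.InjOn Prod.snd (nextBag k b B m) := by
  rcases m with S | w
  · exact h.mono fun x hx => hx.1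
  · dsimp only [nextBag]
    split_ifs with hc
    · rintro x (rfl | hx) y (rfl | hy) hxy
      · rfl
      · exact absurd hxy.symm (hc.2 y hy)
      · exact absurd hxy (hc.2 x hx)
      · exact h hx hy hxy
    · exact h

variable {k : ℕ} {u : W} {mv : List A → Option (Finset W ⊕ W)}

theorem unravelBag_cons (a : A) (l : List A) :
    unravelBag k u mv (a :: l) = unravelBag k u mv l ∨
      ∃ m, unravelBag k u mv (a :: l) = nextBag k (a :: l) (unravelBag k u mv l) m := by
  rw [unravelBag]
  rcases mv (a :: l) with _ | m
  · exact Or.inl rfl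
  · exact Or.inr ⟨m, rfl⟩

theorem finite_ncard_unravelBag (hk : 1 ≤ k) (l : List A) :
    (unravelBag k u mv l).Finite ∧ (unravelBag k u mv l).ncard ≤ k := by
  induction l with
  | nil => exact ⟨Set.finite_singleton _, by rw [unravelBag, Set.ncard_singleton]; exact hk⟩
  | cons a l ih =>
    rcases unravelBag_cons (k := k) (u := u) (mv := mv) a l with h | ⟨m, h⟩ <;> rw [h]
    · exact ih
    · exact finite_ncard_nextBag ih

theorem injOn_unravelBag (l : List A) : Set.InjOn Prod.snd (unravelBag k u mv l) := by
  induction l with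
  | nil => exact Set.injOn_singleton _ _
  | cons a l ih =>
    rcases unravelBag_cons (k := k) (u := u) (mv := mv) a l with h | ⟨m, h⟩ <;> rw [h]
    · exact ih
    · exact injOn_nextBag ih

theorem exists_walk_birth (l : List A) {x : List A × W} (hx : x ∈ unravelBag k u mv l) :
    ∃ p : (listTree A).Walk l x.1, ∀ b ∈ p.support, x ∈ unravelBag k u mv b := by
  induction l with
  | nil =>
    have hx₁ : x.1 = [] := congrArg Prod.fst (Set.mem_singleton_iff.1 hx)
    rw [hx₁]
    exact ⟨.nil, by simpa using hx⟩
  | cons a l ih =>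
    have key : x ∈ unravelBag k u mv l ∨ x.1 = a :: l := by
      rcases unravelBag_cons (k := k) (u := u) (mv := mv) a l with h | ⟨m, h⟩
      · exact Or.inl (h ▸ hx)
      · exact mem_nextBag (h ▸ hx)
    rcases key with h | h
    · obtain ⟨p, hp⟩ := ih h
      refine ⟨.cons (listTree_adj_cons a l) p, fun b hb => ?_⟩
      rcases List.mem_cons.1 (by simpa using hb) with rfl | hb
      · exact hx
      · exact hp b hb
    · rw [h]
      exact ⟨.nil, by simpa using hx⟩

theorem exists_walk_unravelBag {x : List A × W} {l l' : List A}
    (hx : x ∈ unravelBag k u mv l) (hx' : x ∈ unravelBag k u mv l') :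
    ∃ p : (listTree A).Walk l l', ∀ b ∈ p.support, x ∈ unravelBag k u mv b := by
  obtain ⟨p, hp⟩ := exists_walk_birth l hx
  obtain ⟨q, hq⟩ := exists_walk_birth l' hx'
  refine ⟨p.append q.reverse, fun b hb => ?_⟩
  rcases (SimpleGraph.Walk.mem_support_append_iff _ _).1 hb with hb | hb
  · exact hp b hb
  · exact hq b (by simpa using hb)

/-- Every move is available below every node, without changing the bag before performing it. -/
def MovesAvailable (k : ℕ) (u : W) (mv : List A → Option (Finset W ⊕ W)) : Prop :=
  ∀ l m, ∃ a l', unravelBag k u mv l' = unravelBag k u mv l ∧ mv (a :: l') = some m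

theorem MovesAvailable.exists_bag (h : MovesAvailable k u mv) (l : List A)
    (m : Finset W ⊕ W) : ∃ b, unravelBag k u mv b = nextBag k b (unravelBag k u mv l) m := by
  obtain ⟨a, l', hl', hm⟩ := h l m
  exact ⟨a :: l', by rw [unravelBag, hm, hl', Option.elim_some]⟩

theorem MovesAvailable.exists_extend (h : MovesAvailable k u mv) {l : List A}
    {T : Finset W} (hT : T.card < k) {w : W} (hw : w ∉ T) :
    ∃ b, (∀ x ∈ unravelBag k u mv l, x.2 ∈ T → x ∈ unravelBag k u mv b) ∧
      ∃ x ∈ unravelBag k u mv b, x.2 = w := by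
  obtain ⟨b, hb⟩ := h.exists_bag l (.inl T)
  obtain ⟨c, hc⟩ := h.exists_bag b (.inr w)
  have hbT : ∀ x ∈ unravelBag k u mv b, x.2 ∈ T := fun x hx => by
    rw [hb] at hx
    exact hx.2
  have hcard : (unravelBag k u mv b).ncard < k := by
    refine lt_of_le_of_lt ?_ hT
    rw [← Set.ncard_coe_finset]
    exact Set.ncard_le_ncard_of_injOn Prod.snd hbT (injOn_unravelBag b) T.finite_toSet
  have hcond : (unravelBag k u mv b).ncard < k ∧ ∀ x ∈ unravelBag k u mv b, x.2 ≠ w :=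
    ⟨hcard, fun x hx hxw => hw (hxw ▸ hbT x hx)⟩
  rw [nextBag, if_pos hcond] at hc
  refine ⟨c, fun x hx hxT => ?_, (c, w), ?_, rfl⟩
  · rw [hc, hb]
    exact Or.inr ⟨hx, hxT⟩
  · rw [hc]
    exact Or.inl rfl

theorem movesAvailable_all (k : ℕ) (u : W) :
    MovesAvailable (A := Finset W ⊕ W) k u List.head? :=
  fun l m => ⟨m, l, rfl, rfl⟩

/-- The moves on the binary tree: `true` performs no move, and `false` performs a move depending
on the depth. -/
def binaryMove (e : ℕ → Finset W ⊕ W) : List Bool → Option (Finset W ⊕ W)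
  | false :: l => some (e l.length.unpair.1)
  | _ => none

theorem movesAvailable_binaryMove (k : ℕ) (u : W) {e : ℕ → Finset W ⊕ W}
    (he : Function.Surjective e) : MovesAvailable k u (binaryMove e) := by
  intro l m
  obtain ⟨n, rfl⟩ := he m
  have hbag : ∀ d, unravelBag k u (binaryMove e) (List.replicate d true ++ l) =
      unravelBag k u (binaryMove e) l := by
    intro d
    induction d with
    | zero => rfl
    | succ d ih => exact ih
  refine ⟨false, List.replicate (Nat.pair n l.length - l.length) true ++ l, hbag _, ?_⟩
  have hlen : Nat.pair n l.length - l.length + l.length = Nat.pair n l.length :=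
    Nat.sub_add_cancel (Nat.right_le_pair _ _)
  rw [binaryMove, List.length_append, List.length_replicate, hlen, Nat.unpair_pair]

end Unravelling

namespace Struct

variable {A : Type} (K : Struct) (k : ℕ) (u : K.World)
  (mv : List A → Option (Finset K.World ⊕ K.World))

/-- The unravelling of `K` along the tree of lists over `A`. -/
def unravel : Struct where
  World := {x : List A × K.World // ∃ l, x ∈ unravelBag k u mv l}
  rel n r t := K.rel n r (fun i => (t i).1.2) ∧ ∃ l, ∀ i, (t i).1 ∈ unravelBag k u mv l

variable {K k u mv} in
/-- The element of the bags represented by a world of the unravelling. -/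
def copyOf (x : (K.unravel k u mv).World) : List A × K.World := x.1

variable {K k u mv} in
theorem copyOf_injective : Function.Injective (copyOf (K := K) (k := k) (u := u) (mv := mv)) :=
  Subtype.val_injective

variable {K k u mv} in
theorem unravel_rel {n r : ℕ} {t : Fin n → (K.unravel k u mv).World} :
    (K.unravel k u mv).rel n r t ↔ K.rel n r (fun i => (copyOf (t i)).2) ∧
      ∃ l, ∀ i, copyOf (t i) ∈ unravelBag k u mv l := Iff.rfl

/-- The root of the unravelling. -/
def unravelRoot : (K.unravel k u mv).World := ⟨([], u), [], rfl⟩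

/-- The canonical tree decomposition of the unravelling. -/
def unravelDecomp : TreeDecomp (Set.univ : Set (K.unravel k u mv).World)
    (K.unravel k u mv).gadj where
  B := List A
  tree := listTree A
  isTree := listTree_isTree A
  bag l := {x | copyOf x ∈ unravelBag k u mv l}
  cover_vert v _ := v.2
  cover_edge := by
    rintro _ _ ⟨n, r, t, ⟨_, l, hl⟩, ⟨i, rfl⟩, j, rfl⟩
    exact ⟨l, hl i, hl j⟩
  bags_conn _ _ _ := exists_walk_unravelBag

variable {K k u mv}

theorem unravelDecomp_widthLE (hk : 1 ≤ k) : (K.unravelDecomp k u mv).WidthLE (k - 1) := by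
  intro l
  obtain ⟨hfin, hcard⟩ := finite_ncard_unravelBag (u := u) (mv := mv) hk l
  have hsub : copyOf '' ((K.unravelDecomp k u mv).bag l) ⊆ unravelBag k u mv l := by
    rintro _ ⟨x, hx, rfl⟩
    exact hx
  refine ⟨Set.Finite.of_finite_image (hfin.subset hsub) copyOf_injective.injOn, ?_⟩
  rw [Nat.sub_add_cancel hk]
  rw [← Set.ncard_image_of_injective _ copyOf_injective]
  exact (Set.ncard_le_ncard hsub hfin).trans hcard

theorem unravelDecomp_good {mv : List Bool → Option (Finset K.World ⊕ K.World)} :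
    (K.unravelDecomp k u mv).Good := by
  have key : ∀ (a : Bool) (l : List Bool),
      unravelBag k u mv (a :: l) ⊆ unravelBag k u mv l ∨
        unravelBag k u mv l ⊆ unravelBag k u mv (a :: l) := by
    intro a l
    rcases unravelBag_cons (k := k) (u := u) (mv := mv) a l with h | ⟨m, h⟩ <;> rw [h]
    · exact Or.inl subset_rfl
    · exact nextBag_mono_or_anti _ _ _ _
  refine ⟨?_, ([] : List Bool), fun (b : List Bool) => ?_⟩
  · rintro _ _ (⟨a, rfl⟩ | ⟨a, rfl⟩)
    · exact (key a _).symm.imp (fun h x hx => h hx) (fun h x hx => h hx)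
    · exact (key a _).imp (fun h x hx => h hx) (fun h x hx => h hx)
  · refine ⟨(Set.toFinite {true :: b, false :: b, b.tail}).subset (listTree_neighbors_bool b),
      ?_, fun _ => ?_⟩
    · rintro rfl
      exact (Set.ncard_le_ncard listTree_neighbors_bool_nil (Set.toFinite _)).trans
        ((Set.ncard_insert_le _ _).trans (by rw [Set.ncard_singleton]))
    · refine (Set.ncard_le_ncard (listTree_neighbors_bool b) (Set.toFinite _)).trans
        ((Set.ncard_insert_le _ _).trans (Nat.succ_le_succ ?_))
      exact (Set.ncard_insert_le _ _).trans (by rw [Set.ncard_singleton])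

theorem near_of_near_unravel {x y : (K.unravel k u mv).World}
    (h : (K.unravel k u mv).near x y) : K.near (copyOf x).2 (copyOf y).2 := by
  rcases h with rfl | ⟨n, r, t, ⟨h, -⟩, ⟨i, rfl⟩, j, rfl⟩
  · exact Or.inl rfl
  · exact Or.inr ⟨n, r, _, h, ⟨i, rfl⟩, j, rfl⟩

/-- In a Kripke structure, a tuple containing two distinct worlds contains no third one. -/
theorem IsKripke.eq_or_eq (hK : K.IsKripke) {n r : ℕ} {t : Fin n → K.World} (h : K.rel n r t)
    {i j : Fin n} (hij : t i ≠ t j) (a : Fin n) : a = i ∨ a = j := by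
  have hn : n ≤ 2 := not_lt.1 fun hn => hK n hn r t h
  have : i ≠ j := fun e => hij (congrArg t e)
  omega

theorem IsKripke.near_unravel (hK : K.IsKripke) {l : List A} {x y : (K.unravel k u mv).World}
    (hx : copyOf x ∈ unravelBag k u mv l) (hy : copyOf y ∈ unravelBag k u mv l)
    (h : K.near (copyOf x).2 (copyOf y).2) : (K.unravel k u mv).near x y := by
  by_cases hxy : (copyOf x).2 = (copyOf y).2
  · exact Or.inl (copyOf_injective (injOn_unravelBag l hx hy hxy))
  · obtain ⟨n, r, t, ht, ⟨i, hi⟩, j, hj⟩ := h.resolve_left hxy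
    have hij : t i ≠ t j := by rwa [hi, hj]
    have hji : j ≠ i := fun e => hij (congrArg t e.symm)
    refine Or.inr ⟨n, r, fun a => if a = i then x else y, unravel_rel.2 ⟨?_, l, fun a => ?_⟩,
      ⟨i, if_pos rfl⟩, j, if_neg hji⟩
    · convert ht using 2 with a
      rcases hK.eq_or_eq ht hij a with rfl | rfl
      · simp only [if_true, hi]
      · simp only [if_neg hji, hj]
    · split_ifs
      · exact hx
      · exact hy

theorem bisimStep_unravel (hK : K.IsKripke) (hk : 1 ≤ k) (hmv : MovesAvailable k u mv) :
    BisimStep K (K.unravel k u mv) k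
      (fun a b => ∃ l, ∀ i, copyOf (b i) ∈ unravelBag k u mv l ∧ (copyOf (b i)).2 = a i)
      (fun b a => ∀ i, (copyOf (b i)).2 = a i) where
  hom := by
    rintro a b ⟨l, hl⟩
    refine ⟨fun i j hij => copyOf_injective (injOn_unravelBag l (hl i).1 (hl j).1 ?_),
      fun n r t ht => unravel_rel.2 ⟨?_, l, fun i => (hl _).1⟩⟩
    · rw [(hl i).2, (hl j).2, hij]
    · simpa only [(hl _).2] using ht
  step := by
    rintro a b ⟨l, hl⟩ i j w hj hw
    classical
    have extend : ∀ (c : List A) (y : (K.unravel k u mv).World), copyOf y ∈ unravelBag k u mv c →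
        (copyOf y).2 = w → (∀ j, j ≠ i → copyOf (b j) ∈ unravelBag k u mv c) →
        ∃ w', (K.unravel k u mv).near (b j) w' ∧ ∃ l, ∀ i',
          copyOf (Function.update b i w' i') ∈ unravelBag k u mv l ∧
          (copyOf (Function.update b i w' i')).2 = Function.update a i w i' := by
      intro c y hy hyw hc
      refine ⟨y, hK.near_unravel (hc j hj) hy (by rwa [(hl j).2, hyw]), c, fun i' => ?_⟩
      by_cases hi' : i' = i
      · subst hi'
        simpa only [Function.update_self] using ⟨hy, hyw⟩
      · simpa only [Function.update_of_ne hi'] using ⟨hc i' hi', (hl i').2⟩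
    by_cases hwT : w ∈ (Finset.univ.erase i).image a
    · obtain ⟨j', -, hj'⟩ := Finset.mem_image.1 hwT
      exact extend l (b j') (hl j').1 ((hl j').2.trans hj') fun j _ => (hl j).1
    · have hcard : ((Finset.univ.erase i).image a).card < k := by
        refine lt_of_le_of_lt Finset.card_image_le ?_
        rw [Finset.card_erase_of_mem (Finset.mem_univ i), Finset.card_univ, Fintype.card_fin]
        exact Nat.sub_lt hk one_pos
      obtain ⟨c, hc, y, hy, hyw⟩ := hmv.exists_extend (l := l) hcard hwT
      refine extend c ⟨y, c, hy⟩ hy hyw fun j' hj' => hc _ (hl j').1 ?_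
      rw [(hl j').2]
      exact Finset.mem_image_of_mem _ (Finset.mem_erase.2 ⟨hj', Finset.mem_univ _⟩)
  swap := by
    rintro a b ⟨l, hl⟩ _ i
    exact (hl i).2

theorem bisimStep_project (hk : 1 ≤ k) :
    BisimStep (K.unravel k u mv) K k
      (fun b a => ∀ i, (copyOf (b i)).2 = a i)
      (fun a b => ∃ l, ∀ i, copyOf (b i) ∈ unravelBag k u mv l ∧ (copyOf (b i)).2 = a i) where
  hom := by
    intro b a h
    refine ⟨fun i j hij => by rw [← h, ← h, hij], fun n r t ht => ?_⟩
    simpa only [← h] using (unravel_rel.1 ht).1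
  step := by
    intro b a h i j w _ hw
    refine ⟨(copyOf w).2, by rw [← h]; exact near_of_near_unravel hw, fun i' => ?_⟩
    by_cases hi' : i' = i
    · subst hi'
      simp only [Function.update_self]
    · simpa only [Function.update_of_ne hi'] using h i'
  swap := by
    intro b a h hb
    obtain ⟨l, hl⟩ := (b ⟨0, hk⟩).2
    exact ⟨l, fun i => ⟨by rw [hb i ⟨0, hk⟩]; exact hl, h i⟩⟩

theorem bisim_unravel (hK : K.IsKripke) (hk : 1 ≤ k) (hmv : MovesAvailable k u mv) :
    Bisim K (K.unravel k u mv) k (pad1 k u) (pad1 k (K.unravelRoot k u mv)) :=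
  ⟨(bisimStep_unravel hK hk hmv).halfBisim (bisimStep_project hk) ⟨[], fun _ => ⟨rfl, rfl⟩⟩,
    (bisimStep_project hk).halfBisim (bisimStep_unravel hK hk hmv) fun _ => rfl⟩

end Struct

/-- For every `k ≥ 2`, every Kripke structure `K` and world `u`
there is a Kripke structure `K'` of tree-width at most `k-1` and a world `u'`
with `K,u ⇄_k K',u'`; moreover if `K` is countable then `K'` admits a countable
good tree decomposition of width at most `k-1`. -/
theorem statement_9 (k : ℕ) (hk : 2 ≤ k) (K : Struct) (hK : K.IsKripke) (u : K.World) :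
    ∃ (K' : Struct) (u' : K'.World), K'.IsKripke ∧
      K'.twLE (k - 1) ∧
      Bisim K K' k (pad1 k u) (pad1 k u') ∧
      (Countable K.World →
        ∃ td : TreeDecomp (Set.univ : Set K'.World) K'.gadj,
          td.WidthLE (k - 1) ∧ Countable td.B ∧ td.Good) := by
  have hk₁ : 1 ≤ k := one_le_two.trans hk
  by_cases hc : Countable K.World
  · have : Nonempty (Finset K.World ⊕ K.World) := ⟨.inr u⟩
    obtain ⟨e, he⟩ := exists_surjective_nat (Finset K.World ⊕ K.World)
    exact ⟨K.unravel k u (binaryMove e), K.unravelRoot k u _,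
      fun n hn r t h => hK n hn r _ h.1,
      ⟨K.unravelDecomp k u _, Struct.unravelDecomp_widthLE hk₁⟩,
      Struct.bisim_unravel hK hk₁ (movesAvailable_binaryMove k u he),
      fun _ => ⟨K.unravelDecomp k u _, Struct.unravelDecomp_widthLE hk₁,
        inferInstanceAs (Countable (List Bool)), Struct.unravelDecomp_good⟩⟩
  · exact ⟨K.unravel k u List.head?, K.unravelRoot k u _,
      fun n hn r t h => hK n hn r _ h.1,
      ⟨K.unravelDecomp k u _, Struct.unravelDecomp_widthLE hk₁⟩,
      Struct.bisim_unravel hK hk₁ (movesAvailable_all k u),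
      fun h => absurd h hc⟩

end PaperCPDL
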